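/- Let k, m, n be integers satisfying 2km + m² = 0, k² − k = 0, and 2kn + 2mn + n(n+1) = 0. Then the function F(x₁,x₂,x₃) = x₁^k · x_p^m · x^n, where x_p = √(x₁² + x₂²) and x = √(x₁² + x₂² + x₃²), is harmonic on the open set {(x₁,x₂,x₃) ∈ ℝ³ : x₁² + x₂² > 0}: ΔF = 0 at every such point. -/

import Mathlib

/-- The Laplacian `∂²F/∂x₁² + ∂²F/∂x₂² + ∂²F/∂x₃²` of a function `F : ℝ → ℝ → ℝ → ℝ`
(curried function of three real variables) at the point `(a, b, c)`. -/
noncomputable def lap3 (F : ℝ → ℝ → ℝ → ℝ) (a b c : ℝ) : ℝ :=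
  deriv (fun s => deriv (fun u => F u b c) s) a +
  deriv (fun s => deriv (fun u => F a u c) s) b +
  deriv (fun s => deriv (fun u => F a b u) s) c

open Filter Topology

lemma hasDerivAt_sqrt_sq_add_zpow (m : ℤ) (p s : ℝ) (h : 0 < s ^ 2 + p) :
    HasDerivAt (fun u : ℝ => Real.sqrt (u ^ 2 + p) ^ m)
      (m * s * Real.sqrt (s ^ 2 + p) ^ (m - 2)) s := by
  have hP : Real.sqrt (s ^ 2 + p) ≠ 0 := (Real.sqrt_pos.2 h).ne'
  have h1 : HasDerivAt (fun u : ℝ => u ^ 2 + p) (2 * s) s := by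
    simpa using (hasDerivAt_pow 2 s).add_const p
  refine ((hasDerivAt_zpow m _ (Or.inl hP)).comp s (h1.sqrt h.ne')).congr_deriv ?_
  rw [show m - 1 = (m - 2) + 1 by ring, zpow_add_one₀ hP]
  field_simp

lemma deriv_deriv_affine_mul_sqrt_zpow (α β : ℝ) (m n : ℤ) (p q s : ℝ)
    (hp : 0 < s ^ 2 + p) (hq : 0 < s ^ 2 + q) :
    deriv (fun t => deriv (fun u : ℝ => (α * u + β) * Real.sqrt (u ^ 2 + p) ^ m *
      Real.sqrt (u ^ 2 + q) ^ n) t) s =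
    2 * α * s * (m * Real.sqrt (s ^ 2 + p) ^ (m - 2) * Real.sqrt (s ^ 2 + q) ^ n +
      n * Real.sqrt (s ^ 2 + p) ^ m * Real.sqrt (s ^ 2 + q) ^ (n - 2)) +
    (α * s + β) *
      ((m * Real.sqrt (s ^ 2 + p) ^ (m - 2) +
          m * (m - 2) * s ^ 2 * Real.sqrt (s ^ 2 + p) ^ (m - 2 - 2)) *
          Real.sqrt (s ^ 2 + q) ^ n +
        2 * m * n * s ^ 2 * Real.sqrt (s ^ 2 + p) ^ (m - 2) * Real.sqrt (s ^ 2 + q) ^ (n - 2) +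
        Real.sqrt (s ^ 2 + p) ^ m * (n * Real.sqrt (s ^ 2 + q) ^ (n - 2) +
          n * (n - 2) * s ^ 2 * Real.sqrt (s ^ 2 + q) ^ (n - 2 - 2))) := by
  have hl (t : ℝ) : HasDerivAt (fun u : ℝ => α * u + β) α t := by
    simpa using ((hasDerivAt_id t).const_mul α).add_const β
  have hid (c : ℝ) : HasDerivAt (fun u : ℝ => c * u) c s := by
    simpa using (hasDerivAt_id s).const_mul c
  have hfirst : (fun t => deriv (fun u : ℝ => (α * u + β) * Real.sqrt (u ^ 2 + p) ^ m *
      Real.sqrt (u ^ 2 + q) ^ n) t) =ᶠ[𝓝 s] fun t =>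
      (α * Real.sqrt (t ^ 2 + p) ^ m +
        (α * t + β) * (m * t * Real.sqrt (t ^ 2 + p) ^ (m - 2))) * Real.sqrt (t ^ 2 + q) ^ n +
      (α * t + β) * Real.sqrt (t ^ 2 + p) ^ m * (n * t * Real.sqrt (t ^ 2 + q) ^ (n - 2)) := by
    have ep : ∀ᶠ t : ℝ in 𝓝 s, 0 < t ^ 2 + p :=
      (show Continuous fun t : ℝ => t ^ 2 + p by fun_prop).continuousAt.eventually (lt_mem_nhds hp)
    have eq : ∀ᶠ t : ℝ in 𝓝 s, 0 < t ^ 2 + q :=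
      (show Continuous fun t : ℝ => t ^ 2 + q by fun_prop).continuousAt.eventually (lt_mem_nhds hq)
    filter_upwards [ep, eq] with t h1 h2
    exact (((hl t).mul (hasDerivAt_sqrt_sq_add_zpow m p t h1)).mul
      (hasDerivAt_sqrt_sq_add_zpow n q t h2)).deriv
  rw [hfirst.deriv_eq]
  have hP (j : ℤ) := hasDerivAt_sqrt_sq_add_zpow j p s hp
  have hQ (j : ℤ) := hasDerivAt_sqrt_sq_add_zpow j q s hq
  refine ((((((hP m).const_mul α).add ((hl s).mul ((hid m).mul (hP (m - 2))))).mul (hQ n)).add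
    (((hl s).mul (hP m)).mul ((hid n).mul (hQ (n - 2))))).congr_deriv ?_).deriv
  simp only [Pi.add_apply, Pi.mul_apply]
  push_cast
  ring

/-- If the integers `k, m, n` satisfy `2km + m² = 0`, `k² − k = 0` and
`2kn + 2mn + n(n+1) = 0`, then `F (x₁, x₂, x₃) = x₁^k · x_p^m · x^n`,
with `x_p = √(x₁² + x₂²)` and `x = √(x₁² + x₂² + x₃²)` and integer (zpow) exponents,
is harmonic on the open set `{x₁² + x₂² > 0}`. -/
theorem harmonic_monomials_nested (k m n : ℤ)
    (h1 : 2 * k * m + m ^ 2 = 0) (h2 : k ^ 2 - k = 0)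
    (h3 : 2 * k * n + 2 * m * n + n * (n + 1) = 0)
    (x₁ x₂ x₃ : ℝ) (h : 0 < x₁ ^ 2 + x₂ ^ 2) :
    lap3 (fun a b c =>
        a ^ k * Real.sqrt (a ^ 2 + b ^ 2) ^ m *
          Real.sqrt (a ^ 2 + b ^ 2 + c ^ 2) ^ n) x₁ x₂ x₃ = 0 := by
  obtain ⟨α, β, hlin, hα⟩ : ∃ α β : ℝ, (∀ u : ℝ, u ^ k = α * u + β) ∧
      α * x₁ = k * (α * x₁ + β) := by
    obtain rfl | rfl : k = 0 ∨ k = 1 := by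
      rcases mul_eq_zero.1 (show k * (k - 1) = 0 by linarith) with h | h
      · exact Or.inl h
      · exact Or.inr (by linarith)
    · exact ⟨0, 1, by simp, by simp⟩
    · exact ⟨1, 0, by simp, by simp⟩
  have hr : 0 < x₁ ^ 2 + x₂ ^ 2 + x₃ ^ 2 := by positivity
  have e1 := deriv_deriv_affine_mul_sqrt_zpow α β m n (x₂ ^ 2) (x₂ ^ 2 + x₃ ^ 2) x₁ h
    (by linarith)
  have e2 := deriv_deriv_affine_mul_sqrt_zpow 0 (α * x₁ + β) m n (x₁ ^ 2) (x₁ ^ 2 + x₃ ^ 2) x₂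
    (by linarith) (by linarith)
  have e3 := deriv_deriv_affine_mul_sqrt_zpow 0
    ((α * x₁ + β) * Real.sqrt (x₁ ^ 2 + x₂ ^ 2) ^ m) 0 n 1 (x₁ ^ 2 + x₂ ^ 2) x₃
    (by positivity) (by linarith)
  have c1 (u : ℝ) : u ^ 2 + (x₂ ^ 2 + x₃ ^ 2) = u ^ 2 + x₂ ^ 2 + x₃ ^ 2 := by ring
  have c2 (u : ℝ) : u ^ 2 + (x₁ ^ 2 + x₃ ^ 2) = x₁ ^ 2 + u ^ 2 + x₃ ^ 2 := by ring
  have c2' (u : ℝ) : u ^ 2 + x₁ ^ 2 = x₁ ^ 2 + u ^ 2 := by ring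
  have c3 (u : ℝ) : u ^ 2 + (x₁ ^ 2 + x₂ ^ 2) = x₁ ^ 2 + x₂ ^ 2 + u ^ 2 := by ring
  simp only [c1] at e1
  simp only [c2, c2', zero_mul, zero_add] at e2
  simp only [c3, zero_mul, zero_add, zpow_zero, mul_one] at e3
  simp only [lap3, hlin]
  rw [e1, e2, e3]
  have hP := (Real.sqrt_pos.2 h).ne'
  have hR := (Real.sqrt_pos.2 hr).ne'
  have hP2 := Real.sq_sqrt h.le
  have hR2 := Real.sq_sqrt hr.le
  set P := Real.sqrt (x₁ ^ 2 + x₂ ^ 2)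
  set R := Real.sqrt (x₁ ^ 2 + x₂ ^ 2 + x₃ ^ 2)
  have zP (j : ℤ) : P ^ j = P ^ (j - 2) * (x₁ ^ 2 + x₂ ^ 2) := by
    rw [← hP2, ← zpow_natCast, ← zpow_add₀ hP]; simp
  have zR (j : ℤ) : R ^ j = R ^ (j - 2) * (x₁ ^ 2 + x₂ ^ 2 + x₃ ^ 2) := by
    rw [← hR2, ← zpow_natCast, ← zpow_add₀ hR]; simp
  have h1' : 2 * (k : ℝ) * m + (m : ℝ) ^ 2 = 0 := by exact_mod_cast h1
  have h3' : 2 * (k : ℝ) * n + 2 * m * n + n * (n + 1) = 0 := by exact_mod_cast h3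
  rw [zP m, zP (m - 2), zR n, zR (n - 2)]
  generalize P ^ (m - 2 - 2) = A
  generalize R ^ (n - 2 - 2) = B
  set ρ := x₁ ^ 2 + x₂ ^ 2
  set r := ρ + x₃ ^ 2
  push_cast
  linear_combination (α * x₁ + β) * (A * ρ) * (B * r * r) * h1' +
    (α * x₁ + β) * (A * ρ * ρ) * (B * r) * h3' +
    2 * (m * A * ρ * B * r * r + n * A * ρ * ρ * B * r) * hα
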